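/- For every two-sided matching market (P, A, U) with unique acceptor-optimal stable matching μ*, and every δ ∈ (0, 1], there exist an experimentation rate ε > 0 and a completely uncoupled acceptor policy π*_A such that, if every proposer follows proposer trial-and-error learning (PTL) with experimentation rate ε and every acceptor follows π*_A, then for all sufficiently large t the probability that the matching formed at time t equals μ* is strictly greater than 1 − δ. -/

import Mathlib

open scoped ENNReal Classical

noncomputable section

/-- A two-sided matching market: proposers `P`, acceptors `A`, and injective
utility functions with values in `[0,1)` assigning `0` to being unmatched. -/
structure Market (P A : Type) where
  uP : P → Option A → ℝ
  uA : A → Option P → ℝ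
  uP_inj : ∀ i, Function.Injective (uP i)
  uA_inj : ∀ j, Function.Injective (uA j)
  uP_mem : ∀ i o, uP i o ∈ Set.Ico (0 : ℝ) 1
  uA_mem : ∀ j o, uA j o ∈ Set.Ico (0 : ℝ) 1
  uP_none : ∀ i, uP i none = 0
  uA_none : ∀ j, uA j none = 0

/-- A (pre-)matching / action profile: each proposer points to an optional acceptor and
each acceptor points to an optional proposer. -/
abbrev Profile (P A : Type) := (P → Option A) × (A → Option P)

variable {P A : Type}

/-- The partner of proposer `i` in the matching induced by the action profile `a`
(reciprocated choices only). -/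
def matchedP (a : Profile P A) (i : P) : Option A :=
  match a.1 i with
  | some j => if a.2 j = some i then some j else none
  | none => none

/-- The partner of acceptor `j` in the matching induced by the action profile `a`. -/
def matchedA (a : Profile P A) (j : A) : Option P :=
  match a.2 j with
  | some i => if a.1 i = some j then some i else none
  | none => none

/-- The matching induced by an action profile. -/
def induced (a : Profile P A) : Profile P A := (matchedP a, matchedA a)

/-- A profile is a genuine matching when the two partner functions are mutually consistent. -/
def Consistent (μ : Profile P A) : Prop := ∀ i j, μ.1 i = some j ↔ μ.2 j = some i

/-- `(i, j)` is a blocking pair for the matching `μ`. -/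
def Blocking (M : Market P A) (μ : Profile P A) (i : P) (j : A) : Prop :=
  M.uP i (μ.1 i) < M.uP i (some j) ∧ M.uA j (μ.2 j) < M.uA j (some i)

/-- A matching is stable when it admits no blocking pair. -/
def Stable (M : Market P A) (μ : Profile P A) : Prop := ∀ i j, ¬ Blocking M μ i j

/-- Utility received by proposer `i` under the action profile `a`. -/
def utilP (M : Market P A) (a : Profile P A) (i : P) : ℝ := M.uP i (matchedP a i)

/-- Utility received by acceptor `j` under the action profile `a`. -/
def utilA (M : Market P A) (a : Profile P A) (j : A) : ℝ := M.uA j (matchedA a j)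

/-- The set of proposers proposing to acceptor `j` under proposer actions `ap`. -/
def proposals [Fintype P] (ap : P → Option A) (j : A) : Finset P :=
  Finset.univ.filter fun i => ap i = some j

/-- A (sub)distribution on `α`, given by its mass function. -/
abbrev ProbMass (α : Type) := α → ℝ≥0∞

/-- `d` is a probability distribution. -/
def IsProbMass {α : Type} (d : ProbMass α) : Prop := (∑' x, d x) = 1

/-- A completely uncoupled proposer policy: a mixed action depending only on the
proposer's own past actions and realized utilities. -/
abbrev PPolicy (P A : Type) := List (Option A × ℝ) → ProbMass (Option A)

/-- A completely uncoupled acceptor policy: a mixed action depending only on the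
acceptor's current proposal set and its own past proposal sets, actions and utilities. -/
abbrev APolicy (P A : Type) := Finset P → List (Finset P × Option P × ℝ) → ProbMass (Option P)

/-- Proposer `i`'s private view of a history (most recent first). -/
def pview (M : Market P A) (i : P) (h : List (Profile P A)) : List (Option A × ℝ) :=
  h.map fun a => (a.1 i, utilP M a i)

/-- Acceptor `j`'s private view of a history (most recent first). -/
def aview [Fintype P] (M : Market P A) (j : A) (h : List (Profile P A)) :
    List (Finset P × Option P × ℝ) :=
  h.map fun a => (proposals a.1 j, a.2 j, utilA M a j)

/-- Probability that the next joint action profile is `a` given the history `h`,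
all agents choosing independently according to their policies. -/
def stepProb [Fintype P] [Fintype A] (M : Market P A) (piP : PPolicy P A) (piA : APolicy P A)
    (h : List (Profile P A)) (a : Profile P A) : ℝ≥0∞ :=
  (∏ i, piP (pview M i h) (a.1 i)) * ∏ j, piA (proposals a.1 j) (aview M j h) (a.2 j)

/-- Probability of observing the history `h` (most recent profile first) after `t` steps. -/
def trajProb [Fintype P] [Fintype A] (M : Market P A) (piP : PPolicy P A) (piA : APolicy P A) :
    ℕ → List (Profile P A) → ℝ≥0∞
  | 0, [] => 1
  | 0, _ :: _ => 0
  | _ + 1, [] => 0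
  | t + 1, a :: h => trajProb M piP piA t h * stepProb M piP piA h a

/-- Probability of the event `S` (a set of length-`t` histories) at time `t`. -/
def eventProb [Fintype P] [Fintype A] (M : Market P A) (piP : PPolicy P A) (piA : APolicy P A)
    (t : ℕ) (S : Set (List (Profile P A))) : ℝ≥0∞ :=
  ∑' h, Set.indicator S (trajProb M piP piA t) h

/-- An acceptor policy is valid if it always returns a probability distribution supported
on the received proposals together with the empty action. -/
def APolicyValid (piA : APolicy P A) : Prop :=
  ∀ S h, IsProbMass (piA S h) ∧ ∀ i : P, piA S h (some i) ≠ 0 → i ∈ S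

/-- Moods: content, hopeful, watchful, discontent. -/
inductive Mood | C | H | W | D
deriving DecidableEq

/-- The state of a proposer in trial-and-error learning. -/
structure PState (A : Type) where
  mood : Mood
  base : Option A
  baseU : ℝ
  trial : Option A
  trialU : ℝ

/-- PTL action rule (Algorithm 1a) with experimentation rate `ε`. -/
def ptlAct [Fintype A] (eps : ℝ) (x : PState A) : ProbMass (Option A) := fun o =>
  match x.mood with
  | Mood.C | Mood.D =>
      (if o = none then ENNReal.ofReal eps ^ 2 else 0)
      + (if o.isSome then ENNReal.ofReal eps / (Fintype.card A : ℝ≥0∞) else 0)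
      + (if o = x.base then 1 - ENNReal.ofReal eps - ENNReal.ofReal eps ^ 2 else 0)
  | Mood.H => if o = x.trial then 1 else 0
  | Mood.W => if o = x.base then 1 else 0

/-- PTL state update rule (Algorithm 1b), upon playing `a` and receiving utility `u`. -/
def ptlUpdate (x : PState A) (a : Option A) (u : ℝ) : PState A :=
  match x.mood with
  | Mood.C =>
      if a = x.base then
        if u < x.baseU then ⟨Mood.W, x.base, x.baseU, none, 0⟩
        else if u = x.baseU then ⟨Mood.C, x.base, x.baseU, none, 0⟩
        else ⟨Mood.H, x.base, x.baseU, a, u⟩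
      else
        if u ≤ x.baseU then ⟨Mood.C, x.base, x.baseU, none, 0⟩
        else ⟨Mood.H, x.base, x.baseU, a, u⟩
  | Mood.H =>
      if u = x.trialU then ⟨Mood.C, x.trial, x.trialU, none, 0⟩
      else if x.baseU = 0 then ⟨Mood.D, none, 0, none, 0⟩
      else ⟨Mood.C, x.base, x.baseU, none, 0⟩
  | Mood.W =>
      if u < x.baseU then ⟨Mood.D, none, 0, none, 0⟩
      else ⟨Mood.C, x.base, x.baseU, none, 0⟩
  | Mood.D =>
      if u = x.baseU then ⟨Mood.D, none, 0, none, 0⟩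
      else ⟨Mood.H, x.base, x.baseU, a, u⟩

/-- The initial proposer state: discontent, with empty baseline. -/
def initPState : PState A := ⟨Mood.D, none, 0, none, 0⟩

/-- The PTL state reached after the private history `h` (most recent first). -/
def ptlStateOf (h : List (Option A × ℝ)) : PState A :=
  h.foldr (fun au x => ptlUpdate x au.1 au.2) initPState

/-- Proposer trial-and-error learning, as a completely uncoupled policy. -/
def PTL [Fintype A] (eps : ℝ) : PPolicy P A := fun h => ptlAct eps (ptlStateOf h)

/-- A maximizer of `f` on `s`, or `none` when `s` is empty. -/
def argmaxOn {α : Type} (f : α → ℝ) (s : Finset α) : Option α :=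
  if h : s.Nonempty then some (s.exists_max_image f h).choose else none

theorem argmaxOn_eq_some {α : Type} {f : α → ℝ} {s : Finset α} {x : α}
    (h : argmaxOn f s = some x) : x ∈ s ∧ ∀ y ∈ s, f y ≤ f x := by
  unfold argmaxOn at h
  split_ifs at h with hs
  obtain rfl := Option.some.inj h
  exact (s.exists_max_image f hs).choose_spec

theorem argmaxOn_eq_none {α : Type} {f : α → ℝ} {s : Finset α}
    (h : argmaxOn f s = none) : s = ∅ := by
  unfold argmaxOn at h
  split_ifs at h with hs
  exact Finset.not_nonempty_iff_eq_empty.mp hs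

theorem exists_argmaxOn {α : Type} {f : α → ℝ} {s : Finset α} {y : α} (hy : y ∈ s) :
    ∃ x, argmaxOn f s = some x ∧ x ∈ s ∧ f y ≤ f x := by
  cases h : argmaxOn f s with
  | none => simp [argmaxOn_eq_none h] at hy
  | some x => exact ⟨x, rfl, (argmaxOn_eq_some h).1, (argmaxOn_eq_some h).2 y hy⟩

theorem Market.uP_some_pos (M : Market P A) (i : P) (j : A) : 0 < M.uP i (some j) := by
  refine lt_of_le_of_ne (M.uP_mem i _).1 fun h => ?_
  rw [← M.uP_none i] at h
  cases M.uP_inj i h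

theorem Market.uA_some_pos (M : Market P A) (j : A) (i : P) : 0 < M.uA j (some i) := by
  refine lt_of_le_of_ne (M.uA_mem j _).1 fun h => ?_
  rw [← M.uA_none j] at h
  cases M.uA_inj j h

section DeferredAcceptance

variable [Fintype P] [Fintype A]

/-- The acceptors courting proposer `i` when acceptor `j` courts `τ j`. -/
def courters (τ : A → Option P) (i : P) : Finset A :=
  Finset.univ.filter fun j => τ j = some i

theorem mem_courters {τ : A → Option P} {i : P} {j : A} : j ∈ courters τ i ↔ τ j = some i := by
  simp [courters]

/-- The favourite courter of proposer `i`. -/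
def bestCourter (M : Market P A) (τ : A → Option P) (i : P) : Option A :=
  argmaxOn (fun j => M.uP i (some j)) (courters τ i)

/-- The proposer courted by each acceptor in acceptor-proposing deferred acceptance, given
the sets of proposers that have already rejected it. -/
def daTarget (M : Market P A) (R : A → Finset P) (j : A) : Option P :=
  argmaxOn (fun i => M.uA j (some i)) (R j)ᶜ

/-- One round of acceptor-proposing deferred acceptance. -/
def daStep (M : Market P A) (R : A → Finset P) (j : A) : Finset P :=
  R j ∪ Finset.univ.filter fun i =>
    daTarget M R j = some i ∧ bestCourter M (daTarget M R) i ≠ some j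

/-- The rejection sets after `k` rounds of acceptor-proposing deferred acceptance. -/
def daSeq (M : Market P A) (k : ℕ) : A → Finset P := (daStep M)^[k] fun _ => ∅

theorem daSeq_succ (M : Market P A) (k : ℕ) : daSeq M (k + 1) = daStep M (daSeq M k) :=
  Function.iterate_succ_apply' _ _ _

theorem mem_daStep {M : Market P A} {R : A → Finset P} {i : P} {j : A} :
    i ∈ daStep M R j ↔
      i ∈ R j ∨ (daTarget M R j = some i ∧ bestCourter M (daTarget M R) i ≠ some j) := by
  simp [daStep]

theorem daSeq_mono (M : Market P A) : Monotone (daSeq M) := by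
  refine monotone_nat_of_le_succ fun k j i hi => ?_
  rw [daSeq_succ, mem_daStep]
  exact Or.inl hi

theorem exists_daSeq_fixed (M : Market P A) : ∃ N, daStep M (daSeq M N) = daSeq M N := by
  obtain ⟨N, hN⟩ := WellFoundedGT.monotone_chain_condition (⟨daSeq M, daSeq_mono M⟩ : ℕ →o _)
  exact ⟨N, by rw [← daSeq_succ]; exact (hN (N + 1) (Nat.le_succ N)).symm⟩

/-- No acceptor is ever rejected by its partner in a stable matching. -/
theorem daSeq_not_mem_of_stable (M : Market P A) {μ : Profile P A} (hcons : Consistent μ)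
    (hstab : Stable M μ) (k : ℕ) : ∀ i j, μ.2 j = some i → i ∉ daSeq M k j := by
  induction k with
  | zero => intro i j _; simp [daSeq]
  | succ k ih =>
    intro i j hij hmem
    rw [daSeq_succ, mem_daStep] at hmem
    rcases hmem with hmem | ⟨ht, hb⟩
    · exact ih i j hij hmem
    · obtain ⟨j', hj', hc, hle⟩ := exists_argmaxOn (f := fun j => M.uP i (some j))
        (mem_courters.2 ht)
      have hne : j' ≠ j := by
        rintro rfl
        exact hb hj'
      have hμi : μ.1 i = some j := (hcons i j).2 hij
      refine hstab i j' ⟨?_, ?_⟩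
      · rw [hμi]
        exact lt_of_le_of_ne hle fun h => hne (Option.some.inj (M.uP_inj i h)).symm
      · have ht' := mem_courters.1 hc
        cases hμ : μ.2 j' with
        | none => rw [M.uA_none]; exact M.uA_some_pos j' i
        | some i' =>
          have hle' := (argmaxOn_eq_some ht').2 i' (by simpa using ih i' j' hμ)
          refine lt_of_le_of_ne hle' fun h => ?_
          obtain rfl := Option.some.inj (M.uA_inj j' h)
          rw [← hcons, hμi] at hμ
          exact hne (Option.some.inj hμ).symm

/-- A proposer that has rejected an acceptor is courted by one it prefers. -/
theorem daSeq_better_courter (M : Market P A) (k : ℕ) : ∀ i j, i ∈ daSeq M k j →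
    ∃ j', daTarget M (daSeq M k) j' = some i ∧ M.uP i (some j) < M.uP i (some j') := by
  induction k with
  | zero => intro i j h; simp [daSeq] at h
  | succ k ih =>
    intro i j hmem
    have key : ∃ j', daTarget M (daSeq M k) j' = some i ∧
        bestCourter M (daTarget M (daSeq M k)) i = some j' ∧
        M.uP i (some j) < M.uP i (some j') := by
      rw [daSeq_succ, mem_daStep] at hmem
      rcases hmem with hmem | ⟨ht, hb⟩
      · obtain ⟨j', ht, hlt⟩ := ih i j hmem
        obtain ⟨b, hb, hc, hle⟩ := exists_argmaxOn (f := fun j => M.uP i (some j))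
          (mem_courters.2 ht)
        exact ⟨b, mem_courters.1 hc, hb, hlt.trans_le hle⟩
      · obtain ⟨b, hb', hc, hle⟩ := exists_argmaxOn (f := fun j => M.uP i (some j))
          (mem_courters.2 ht)
        refine ⟨b, mem_courters.1 hc, hb', lt_of_le_of_ne hle fun h => ?_⟩
        rw [Option.some.inj (M.uP_inj i h)] at hb
        exact hb hb'
    obtain ⟨j', ht, hb, hlt⟩ := key
    refine ⟨j', ?_, hlt⟩
    have hR : daSeq M (k + 1) j' = daSeq M k j' := by
      ext i'
      rw [daSeq_succ, mem_daStep]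
      refine or_iff_left ?_
      rintro ⟨h1, h2⟩
      rw [ht] at h1
      obtain rfl := Option.some.inj h1
      exact h2 hb
    rw [daTarget, hR]
    exact ht

/-- Acceptor-proposing deferred acceptance terminates in the acceptor-optimal stable matching. -/
theorem daTarget_eq_of_fixed (M : Market P A) {μ : Profile P A} (hcons : Consistent μ)
    (hstab : Stable M μ)
    (hopt : ∀ ν : Profile P A, Consistent ν → Stable M ν → ∀ j, M.uA j (ν.2 j) ≤ M.uA j (μ.2 j))
    {N : ℕ} (hN : daStep M (daSeq M N) = daSeq M N) : daTarget M (daSeq M N) = μ.2 := by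
  set τ := daTarget M (daSeq M N) with hτ
  have hbest : ∀ i j, τ j = some i → bestCourter M τ i = some j := by
    intro i j h
    by_contra hb
    have h1 : i ∈ daSeq M N j := by
      rw [← hN, mem_daStep]
      exact Or.inr ⟨h, hb⟩
    have h2 := (argmaxOn_eq_some h).1
    simp [h1] at h2
  have hνc : Consistent (bestCourter M τ, τ) := fun i j =>
    ⟨fun h => mem_courters.1 (argmaxOn_eq_some h).1, hbest i j⟩
  have hνs : Stable M (bestCourter M τ, τ) := by
    rintro i j ⟨h1, h2⟩
    have hi : i ∈ daSeq M N j := by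
      by_contra hi
      obtain ⟨i', hi', -, hle⟩ := exists_argmaxOn (f := fun i => M.uA j (some i))
        (show i ∈ (daSeq M N j)ᶜ by simpa using hi)
      have : τ j = some i' := hi'
      simp only [this] at h2
      exact absurd hle (not_le.2 h2)
    obtain ⟨j', hj', hlt⟩ := daSeq_better_courter M N i j hi
    have : bestCourter M τ i = some j' := hbest i j' hj'
    simp only [this] at h1
    exact lt_asymm h1 hlt
  funext j
  refine M.uA_inj j (le_antisymm (hopt _ hνc hνs j) ?_)
  cases hμ : μ.2 j with
  | none => rw [M.uA_none]; exact (M.uA_mem j _).1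
  | some i =>
    obtain ⟨i', hi', -, hle⟩ := exists_argmaxOn (f := fun i => M.uA j (some i))
      (show i ∈ (daSeq M N j)ᶜ by simpa using daSeq_not_mem_of_stable M hcons hstab N i j hμ)
    have : τ j = some i' := hi'
    rw [this]
    exact hle

end DeferredAcceptance

section Expectation

variable [Fintype P] [Fintype A]

/-- The expected value of `f` after one further step of the game from the history `h`. -/
def stepE (M : Market P A) (piP : PPolicy P A) (piA : APolicy P A)
    (f : List (Profile P A) → ℝ≥0∞) (h : List (Profile P A)) : ℝ≥0∞ :=
  ∑ a, stepProb M piP piA h a * f (a :: h)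

theorem tsum_list_eq {α : Type} (f : List α → ℝ≥0∞) (hf : f [] = 0) :
    ∑' h, f h = ∑' h, ∑' a, f (a :: h) := by
  have hinj : Function.Injective fun p : List α × α => p.2 :: p.1 := by
    rintro ⟨h, a⟩ ⟨h', a'⟩ heq
    simp only [List.cons.injEq] at heq
    simp [heq.1, heq.2]
  rw [← ENNReal.tsum_prod (f := fun h a => f (a :: h))]
  refine (hinj.tsum_eq (f := f) ?_).symm
  rintro (_ | ⟨a, h⟩) hh
  · exact absurd hf hh
  · exact ⟨(h, a), rfl⟩

theorem tsum_trajProb (M : Market P A) (piP : PPolicy P A) (piA : APolicy P A) (t : ℕ)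
    (f : List (Profile P A) → ℝ≥0∞) :
    ∑' h, trajProb M piP piA t h * f h = (stepE M piP piA)^[t] f [] := by
  induction t generalizing f with
  | zero =>
    rw [tsum_eq_single []]
    · simp [trajProb]
    · rintro (_ | ⟨a, h⟩) hh
      · exact absurd rfl hh
      · simp [trajProb]
  | succ t ih =>
    rw [Function.iterate_succ_apply, ← ih, tsum_list_eq _ (by simp [trajProb])]
    refine tsum_congr fun h => ?_
    rw [tsum_fintype, stepE, Finset.mul_sum]
    exact Finset.sum_congr rfl fun a _ => by rw [trajProb, mul_assoc]

theorem eventProb_eq (M : Market P A) (piP : PPolicy P A) (piA : APolicy P A) (t : ℕ)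
    (S : Set (List (Profile P A))) :
    eventProb M piP piA t S = (stepE M piP piA)^[t] (S.indicator 1) [] := by
  rw [← tsum_trajProb, eventProb]
  refine tsum_congr fun h => ?_
  by_cases hS : h ∈ S <;> simp [hS]

section Iterates

variable (M : Market P A) (piP : PPolicy P A) (piA : APolicy P A)

theorem stepE_mono_of_support {f g : List (Profile P A) → ℝ≥0∞} {h : List (Profile P A)}
    (hfg : ∀ a, stepProb M piP piA h a ≠ 0 → f (a :: h) ≤ g (a :: h)) :
    stepE M piP piA f h ≤ stepE M piP piA g h := by
  refine Finset.sum_le_sum fun a _ => ?_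
  by_cases ha : stepProb M piP piA h a = 0
  · simp [ha]
  · gcongr
    exact hfg a ha

theorem iterate_stepE_le {f g : List (Profile P A) → ℝ≥0∞} (m : ℕ) (h : List (Profile P A))
    (hfg : ∀ l : List (Profile P A), l.length = m → f (l ++ h) ≤ g (l ++ h)) :
    (stepE M piP piA)^[m] f h ≤ (stepE M piP piA)^[m] g h := by
  induction m generalizing h with
  | zero => exact hfg [] rfl
  | succ m ih =>
    rw [Function.iterate_succ_apply', Function.iterate_succ_apply']
    refine stepE_mono_of_support _ _ _ fun a _ => ih _ fun l hl => ?_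
    have := hfg (l ++ [a]) (by simp [hl])
    simpa using this

theorem iterate_stepE_add (f g : List (Profile P A) → ℝ≥0∞) (m : ℕ) (h : List (Profile P A)) :
    (stepE M piP piA)^[m] (fun h => f h + g h) h =
      (stepE M piP piA)^[m] f h + (stepE M piP piA)^[m] g h := by
  induction m generalizing f g with
  | zero => rfl
  | succ m ih =>
    simp only [Function.iterate_succ_apply]
    rw [← ih]
    refine congrArg (fun F => (stepE M piP piA)^[m] F h) (funext fun h => ?_)
    simp only [stepE, mul_add, Finset.sum_add_distrib]

theorem iterate_stepE_mul (c : ℝ≥0∞) (f : List (Profile P A) → ℝ≥0∞) (m : ℕ)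
    (h : List (Profile P A)) :
    (stepE M piP piA)^[m] (fun h => c * f h) h = c * (stepE M piP piA)^[m] f h := by
  induction m generalizing f with
  | zero => rfl
  | succ m ih =>
    simp only [Function.iterate_succ_apply]
    rw [← ih]
    refine congrArg (fun F => (stepE M piP piA)^[m] F h) (funext fun h => ?_)
    simp only [stepE, Finset.mul_sum]
    exact Finset.sum_congr rfl fun a _ => by ring

theorem iterate_stepE_zero (m : ℕ) (h : List (Profile P A)) :
    (stepE M piP piA)^[m] (fun _ => 0) h = 0 := by
  have := iterate_stepE_mul M piP piA 0 (fun _ => 0) m h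
  simpa using this

theorem iterate_stepE_sum {ι : Type} (s : Finset ι) (f : ι → List (Profile P A) → ℝ≥0∞) (m : ℕ)
    (h : List (Profile P A)) :
    (stepE M piP piA)^[m] (fun h => ∑ i ∈ s, f i h) h =
      ∑ i ∈ s, (stepE M piP piA)^[m] (f i) h := by
  induction s using Finset.induction_on with
  | empty => simpa using iterate_stepE_zero M piP piA m h
  | insert i s hi ih =>
    simp only [Finset.sum_insert hi]
    rw [iterate_stepE_add, ih]

end Iterates

variable {M : Market P A} {piP : PPolicy P A} {piA : APolicy P A}

theorem sum_stepProb_fst (hA : APolicyValid piA) (h : List (Profile P A))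
    (G : (P → Option A) → ℝ≥0∞) :
    ∑ a, stepProb M piP piA h a * G a.1 = ∑ ap, (∏ i, piP (pview M i h) (ap i)) * G ap := by
  rw [Fintype.sum_prod_type]
  refine Finset.sum_congr rfl fun ap _ => ?_
  have hone : ∑ aa : A → Option P, ∏ j, piA (proposals ap j) (aview M j h) (aa j) = 1 := by
    have := Finset.prod_univ_sum (fun _ : A => (Finset.univ : Finset (Option P)))
      fun j o => piA (proposals ap j) (aview M j h) o
    rw [Fintype.piFinset_univ] at this
    rw [← this]
    refine Finset.prod_eq_one fun j _ => ?_
    exact (tsum_fintype _).symm.trans (hA _ _).1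
  simp only [stepProb]
  calc _ = ∑ aa : A → Option P, ((∏ i, piP (pview M i h) (ap i)) * G ap) *
        ∏ j, piA (proposals ap j) (aview M j h) (aa j) :=
        Finset.sum_congr rfl fun aa _ => by ring
    _ = _ := by rw [← Finset.mul_sum, hone, mul_one]

theorem sum_stepProb_apply (hP : ∀ v, ∑ o, piP v o = 1) (hA : APolicyValid piA)
    (h : List (Profile P A)) (i : P) (g : Option A → ℝ≥0∞) :
    ∑ a, stepProb M piP piA h a * g (a.1 i) = ∑ o, piP (pview M i h) o * g o := by
  rw [sum_stepProb_fst hA h fun ap => g (ap i)]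
  have := Finset.prod_univ_sum (fun _ : P => (Finset.univ : Finset (Option A)))
      fun i' o => piP (pview M i' h) o * if i' = i then g o else 1
  rw [Fintype.piFinset_univ] at this
  simp only [Finset.prod_mul_distrib, Finset.prod_ite_eq', Finset.mem_univ, if_true] at this
  rw [← this, Finset.prod_eq_single i]
  · simp
  · intro i' _ hne
    simp [hne, hP]
  · simp

theorem stepE_le_of_support (hP : ∀ v, ∑ o, piP v o = 1) (hA : APolicyValid piA)
    {f : List (Profile P A) → ℝ≥0∞} {h : List (Profile P A)} (i : P) (g : Option A → ℝ≥0∞)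
    (hfg : ∀ a, stepProb M piP piA h a ≠ 0 → f (a :: h) ≤ g (a.1 i)) :
    stepE M piP piA f h ≤ ∑ o, piP (pview M i h) o * g o := by
  rw [← sum_stepProb_apply hP hA]
  refine Finset.sum_le_sum fun a _ => ?_
  by_cases ha : stepProb M piP piA h a = 0
  · simp [ha]
  · gcongr
    exact hfg a ha

theorem stepE_const [Nonempty P] (hP : ∀ v, ∑ o, piP v o = 1) (hA : APolicyValid piA) (c : ℝ≥0∞)
    (h : List (Profile P A)) : stepE M piP piA (fun _ => c) h = c := by
  have := sum_stepProb_apply (M := M) hP hA h (Classical.arbitrary P) fun _ => c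
  rw [stepE, this, ← Finset.sum_mul, hP, one_mul]

theorem iterate_stepE_const [Nonempty P] (hP : ∀ v, ∑ o, piP v o = 1) (hA : APolicyValid piA)
    (c : ℝ≥0∞) (m : ℕ) (h : List (Profile P A)) :
    (stepE M piP piA)^[m] (fun _ => c) h = c := by
  induction m with
  | zero => rfl
  | succ m ih =>
    rw [Function.iterate_succ_apply]
    convert ih using 2
    funext h
    exact stepE_const hP hA c h

/-- A Lyapunov weight, increasing in the rank and vanishing exactly at rank zero. -/
def rankWeight (c : ℝ) (r : ℕ) : ℝ≥0∞ := ENNReal.ofReal (1 - (c / 2) ^ r)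

/-- The contraction rate of `rankWeight` for ranks at most five. -/
def rankRate (c : ℝ) : ℝ≥0∞ := ENNReal.ofReal (1 - (c / 2) ^ 5)

/-- `r` stays zero once it vanishes, and otherwise some proposer has an action of probability at
least `c` that makes `r` decrease. -/
def RankDecreases (M : Market P A) (piP : PPolicy P A) (piA : APolicy P A) (c : ℝ)
    (r : List (Profile P A) → ℕ) (h : List (Profile P A)) : Prop :=
  (r h = 0 → ∀ a, stepProb M piP piA h a ≠ 0 → r (a :: h) = 0) ∧
  (r h ≠ 0 → ∃ i d, ENNReal.ofReal c ≤ piP (pview M i h) d ∧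
    ∀ a, stepProb M piP piA h a ≠ 0 → a.1 i = d → r (a :: h) < r h)

theorem rankWeight_mono {c : ℝ} (hc : 0 ≤ c) (hc1 : c ≤ 1) : Monotone (rankWeight c) := by
  intro r s hrs
  refine ENNReal.ofReal_le_ofReal (sub_le_sub_left ?_ 1)
  exact pow_le_pow_of_le_one (by linarith) (by linarith) hrs

theorem rankWeight_le_one {c : ℝ} (hc : 0 ≤ c) (r : ℕ) : rankWeight c r ≤ 1 := by
  rw [rankWeight, ENNReal.ofReal_le_one]
  have : 0 ≤ (c / 2) ^ r := by positivity
  linarith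

theorem one_le_two_mul_rankWeight {c : ℝ} (hc : 0 ≤ c) (hc1 : c ≤ 1) {r : ℕ} (hr : r ≠ 0) :
    1 ≤ 2 * rankWeight c r := by
  have h1 : rankWeight c 1 ≤ rankWeight c r := rankWeight_mono hc hc1 (Nat.one_le_iff_ne_zero.2 hr)
  calc (1 : ℝ≥0∞) ≤ 2 * rankWeight c 1 := by
        rw [rankWeight, show (2 : ℝ≥0∞) = ENNReal.ofReal 2 by simp,
          ← ENNReal.ofReal_mul (by norm_num)]
        rw [ENNReal.one_le_ofReal]
        linarith
    _ ≤ _ := by gcongr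

theorem stepE_rankWeight_le (hP : ∀ v, ∑ o, piP v o = 1) (hA : APolicyValid piA) {c : ℝ}
    (hc : 0 ≤ c) (hc1 : c ≤ 1) {r : List (Profile P A) → ℕ} (hr5 : ∀ h, r h ≤ 5)
    {h : List (Profile P A)} (hr : RankDecreases M piP piA c r h) :
    stepE M piP piA (fun h => rankWeight c (r h)) h ≤ rankRate c * rankWeight c (r h) := by
  by_cases h0 : r h = 0
  · refine (stepE_mono_of_support (g := fun _ => 0) _ _ _ fun a ha => ?_).trans ?_
    · simp [hr.1 h0 a ha, rankWeight]
    · simp [stepE]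
  · obtain ⟨i, d, hd, hlt⟩ := hr.2 h0
    obtain ⟨k, hk⟩ : ∃ k, r h = k + 1 := Nat.exists_eq_succ_of_ne_zero h0
    have hk5 : k + 1 ≤ 5 := hk.symm.trans_le (hr5 h)
    refine (stepE_le_of_support hP hA i (fun o => if o = d then rankWeight c k else 1)
      fun a ha => ?_).trans ?_
    · split_ifs with had
      · have := hlt a ha had
        exact rankWeight_mono hc hc1 (by omega)
      · exact rankWeight_le_one hc _
    · have hsum := hP (pview M i h)
      rw [← Finset.add_sum_erase _ _ (Finset.mem_univ d)] at hsum ⊢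
      have hs : ∑ o ∈ Finset.univ.erase d, piP (pview M i h) o *
          (if o = d then rankWeight c k else 1) = ∑ o ∈ Finset.univ.erase d, piP (pview M i h) o :=
        Finset.sum_congr rfl fun o ho => by simp [Finset.ne_of_mem_erase ho]
      rw [hs, if_pos rfl, hk]
      generalize (∑ o ∈ Finset.univ.erase d, piP (pview M i h) o) = s at hsum
      generalize piP (pview M i h) d = p at hsum hd
      have hp : p ≠ ⊤ := by rintro rfl; simp at hsum
      have hsT : s ≠ ⊤ := by rintro rfl; simp at hsum
      lift p to NNReal using hp
      lift s to NNReal using hsT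
      have hps : (p : ℝ) + s = 1 := by exact_mod_cast hsum
      have hcp : c ≤ p := by
        have := (ENNReal.ofReal_le_iff_le_toReal ENNReal.coe_ne_top).1 hd
        simpa using this
      have hx0 : 0 ≤ (c / 2) ^ k := by positivity
      have hx1 : ∀ n, (c / 2) ^ n ≤ 1 := fun n => pow_le_one₀ (by linarith) (by linarith)
      have hx5 : (c / 2) ^ 5 ≤ (c / 2) ^ (k + 1) :=
        pow_le_pow_of_le_one (by linarith) (by linarith) hk5
      have e1 : (p : ℝ≥0∞) = ENNReal.ofReal p := by simp
      have e2 : (s : ℝ≥0∞) = ENNReal.ofReal s := by simp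
      rw [e1, e2, rankWeight, rankWeight, rankRate, ← ENNReal.ofReal_mul p.coe_nonneg,
        ← ENNReal.ofReal_mul (by linarith [hx1 5]),
        ← ENNReal.ofReal_add (mul_nonneg p.coe_nonneg (by linarith [hx1 k])) s.coe_nonneg]
      refine ENNReal.ofReal_le_ofReal ?_
      have h5 : 0 ≤ (c / 2) ^ 5 := by positivity
      have hk1 : 0 ≤ (c / 2) ^ (k + 1) := by positivity
      have hpk : c * (c / 2) ^ k ≤ p * (c / 2) ^ k := mul_le_mul_of_nonneg_right hcp hx0
      have hsucc : c * (c / 2) ^ k = 2 * (c / 2) ^ (k + 1) := by ring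
      nlinarith [mul_nonneg h5 hk1]

/-- Exponential decay of the probability that a decreasing rank has not yet vanished. -/
theorem iterate_stepE_rank_ne_zero_le (hP : ∀ v, ∑ o, piP v o = 1) (hA : APolicyValid piA) {c : ℝ}
    (hc : 0 ≤ c) (hc1 : c ≤ 1) {r : List (Profile P A) → ℕ} (hr5 : ∀ h, r h ≤ 5) (m : ℕ)
    (h : List (Profile P A))
    (hr : ∀ l : List (Profile P A), l.length < m → RankDecreases M piP piA c r (l ++ h)) :
    (stepE M piP piA)^[m] (fun h => if r h = 0 then 0 else 1) h ≤ 2 * rankRate c ^ m := by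
  have hw : (stepE M piP piA)^[m] (fun h => rankWeight c (r h)) h ≤
      rankRate c ^ m * rankWeight c (r h) := by
    induction m generalizing h with
    | zero => simp
    | succ m ih =>
      rw [Function.iterate_succ_apply']
      calc _ ≤ stepE M piP piA (fun h => rankRate c ^ m * rankWeight c (r h)) h := by
            refine stepE_mono_of_support _ _ _ fun a _ => ih (a :: h) fun l hl => ?_
            have := hr (l ++ [a]) (by simpa using hl)
            simpa using this
        _ = rankRate c ^ m * stepE M piP piA (fun h => rankWeight c (r h)) h :=
            iterate_stepE_mul M piP piA _ (fun h => rankWeight c (r h)) 1 h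
        _ ≤ rankRate c ^ m * (rankRate c * rankWeight c (r h)) := by
            gcongr
            exact stepE_rankWeight_le hP hA hc hc1 hr5 (hr [] (by simp))
        _ = _ := by ring
  calc _ ≤ (stepE M piP piA)^[m] (fun h => 2 * rankWeight c (r h)) h := by
        refine iterate_stepE_le _ _ _ _ _ fun l _ => ?_
        split_ifs with h0
        · exact zero_le
        · exact one_le_two_mul_rankWeight hc hc1 h0
    _ = 2 * (stepE M piP piA)^[m] (fun h => rankWeight c (r h)) h := iterate_stepE_mul ..
    _ ≤ 2 * (rankRate c ^ m * 1) := by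
        gcongr
        exact hw.trans (by gcongr; exact rankWeight_le_one hc _)
    _ = _ := by rw [mul_one]

end Expectation

section Proposer

variable [Fintype A]

theorem sum_ptlAct_explore [Nonempty A] (eps : ℝ) :
    ∑ o : Option A, ((if o = none then ENNReal.ofReal eps ^ 2 else 0) +
      (if o.isSome then ENNReal.ofReal eps / (Fintype.card A : ℝ≥0∞) else 0)) =
      ENNReal.ofReal eps + ENNReal.ofReal eps ^ 2 := by
  rw [Fintype.sum_option]
  simp only [if_true, Option.isSome_none, Option.isSome_some, reduceCtorEq, if_false,
    Finset.sum_const, nsmul_eq_mul, Bool.false_eq_true, add_zero, zero_add, Finset.card_univ]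
  rw [ENNReal.mul_div_cancel (by simp) (by simp), add_comm]

theorem sum_ptlAct [Nonempty A] {eps : ℝ} (h0 : 0 ≤ eps) (h1 : eps + eps ^ 2 ≤ 1) (x : PState A) :
    ∑ o, ptlAct eps x o = 1 := by
  have hE : ENNReal.ofReal eps + ENNReal.ofReal eps ^ 2 ≤ 1 := by
    rw [← ENNReal.ofReal_pow h0, ← ENNReal.ofReal_add h0 (by positivity)]
    exact ENNReal.ofReal_le_one.2 h1
  obtain ⟨mood, b, bu, tr, tu⟩ := x
  cases mood <;> simp only [ptlAct]
  · rw [Finset.sum_add_distrib, sum_ptlAct_explore]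
    simp only [Finset.sum_ite_eq', Finset.mem_univ, if_true]
    rw [tsub_tsub, add_tsub_cancel_of_le hE]
  · simp
  · simp
  · rw [Finset.sum_add_distrib, sum_ptlAct_explore]
    simp only [Finset.sum_ite_eq', Finset.mem_univ, if_true]
    rw [tsub_tsub, add_tsub_cancel_of_le hE]

theorem sum_ptlAct_ne_base_le [Nonempty A] (eps : ℝ) {x : PState A} (hx : x.mood = Mood.C) :
    ∑ o, ptlAct eps x o * (if o = x.base then 0 else 1) ≤
      ENNReal.ofReal eps + ENNReal.ofReal eps ^ 2 := by
  rw [← sum_ptlAct_explore (A := A)]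
  refine Finset.sum_le_sum fun o _ => ?_
  by_cases ho : o = x.base
  · simp [ho]
  · simp [ptlAct, hx, ho]

theorem ofReal_le_ptlAct_some [Nonempty A] {eps : ℝ} {x : PState A}
    (hx : x.mood = Mood.C ∨ x.mood = Mood.D) (j : A) :
    ENNReal.ofReal (eps / Fintype.card A) ≤ ptlAct eps x (some j) := by
  rw [ENNReal.ofReal_div_of_pos (by exact_mod_cast Fintype.card_pos)]
  rcases hx with hx | hx <;>
  simp [ptlAct, hx]

theorem ptlAct_trial {eps : ℝ} {x : PState A} (hx : x.mood = Mood.H) :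
    ptlAct eps x x.trial = 1 := by
  simp [ptlAct, hx]

theorem ptlAct_base_watchful {eps : ℝ} {x : PState A} (hx : x.mood = Mood.W) :
    ptlAct eps x x.base = 1 := by
  simp [ptlAct, hx]


end Proposer

section ProposerState

/-- The invariant satisfied by every PTL state of proposer `i` that can be reached: baselines and
trials are acceptors, recorded with their true utilities. -/
structure PState.Valid (M : Market P A) (i : P) (x : PState A) : Prop where
  content : x.mood = Mood.C → ∃ b, x.base = some b ∧ x.baseU = M.uP i (some b)
  watchful : x.mood = Mood.W → ∃ b, x.base = some b ∧ x.baseU = M.uP i (some b)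
  hopeful : x.mood = Mood.H → (∃ j, x.trial = some j ∧ x.trialU = M.uP i (some j)) ∧
    (x.baseU = 0 ∨ ∃ b, x.base = some b ∧ x.baseU = M.uP i (some b))
  discontent : x.mood = Mood.D → x.baseU = 0

theorem ptlUpdate_valid {M : Market P A} {i : P} {x : PState A} (hx : x.Valid M i)
    {o m : Option A} (hm : m = none ∨ m = o) : (ptlUpdate x o (M.uP i m)).Valid M i := by
  have hnone := M.uP_none i
  have hpos := M.uP_some_pos i
  obtain ⟨mood, b, bu, tr, tu⟩ := x
  cases mood
  · obtain ⟨b, hb, hbu⟩ := hx.content rfl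
    simp only at hb hbu
    subst hb hbu
    have hb := hpos b
    simp only [ptlUpdate]
    split_ifs with h1 h2 h3 h4
    all_goals constructor <;> simp
    · subst h1
      rcases hm with rfl | rfl
      · rw [hnone] at h2; exact absurd hb h2
      · exact absurd rfl h3
    · rcases hm with rfl | rfl
      · rw [hnone] at h4; exact absurd hb.le h4
      · cases m with
        | none => rw [hnone] at h4; exact absurd hb.le h4
        | some j => exact ⟨j, rfl, rfl⟩
  · obtain ⟨⟨j, hj, hju⟩, hb⟩ := hx.hopeful rfl
    simp only at hj hju hb
    simp only [ptlUpdate]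
    split_ifs with h1 h2
    all_goals constructor <;> simp
    · exact ⟨j, hj, hju⟩
    · simpa [h2] using hb
  · obtain ⟨b, hb, hbu⟩ := hx.watchful rfl
    simp only at hb hbu
    simp only [ptlUpdate]
    split_ifs with h1
    all_goals constructor <;> simp
    exact ⟨b, hb, hbu⟩
  · have hb := hx.discontent rfl
    simp only at hb
    subst hb
    simp only [ptlUpdate]
    split_ifs with h1
    all_goals constructor <;> simp
    rcases hm with rfl | rfl
    · exact absurd hnone h1
    · cases m with
      | none => exact absurd hnone h1
      | some j => exact ⟨j, rfl, rfl⟩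

theorem matchedP_eq (a : Profile P A) (i : P) : matchedP a i = none ∨ matchedP a i = a.1 i := by
  unfold matchedP
  cases a.1 i with
  | none => simp
  | some j => by_cases h : a.2 j = some i <;> simp [h]

/-- The PTL state of proposer `i` after the history `h`. -/
def ptlState (M : Market P A) (i : P) (h : List (Profile P A)) : PState A :=
  ptlStateOf (pview M i h)

theorem ptlState_cons (M : Market P A) (i : P) (a : Profile P A) (h : List (Profile P A)) :
    ptlState M i (a :: h) = ptlUpdate (ptlState M i h) (a.1 i) (M.uP i (matchedP a i)) := rfl

theorem ptlState_valid (M : Market P A) (i : P) (h : List (Profile P A)) :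
    (ptlState M i h).Valid M i := by
  induction h with
  | nil => constructor <;> simp [ptlState, ptlStateOf, pview, initPState]
  | cons a h ih => exact ptlUpdate_valid ih (matchedP_eq a i)

/-- The partner of a proposer playing `o` when exactly the acceptors in `J` accept it. -/
def partnerIn (J : Finset A) (o : Option A) : Option A :=
  if ∃ j ∈ J, o = some j then o else none

theorem partnerIn_some_of_mem {J : Finset A} {j : A} (hj : j ∈ J) :
    partnerIn J (some j) = some j := by
  simp [partnerIn, hj]

theorem partnerIn_some_of_not_mem {J : Finset A} {j : A} (hj : j ∉ J) :
    partnerIn J (some j) = none := by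
  simp [partnerIn, hj]

theorem partnerIn_eq (J : Finset A) (o : Option A) :
    partnerIn J o = none ∨ ∃ j ∈ J, o = some j ∧ partnerIn J o = some j := by
  by_cases h : ∃ j ∈ J, o = some j
  · obtain ⟨j, hj, rfl⟩ := h
    exact Or.inr ⟨j, hj, rfl, partnerIn_some_of_mem hj⟩
  · exact Or.inl (by simp only [partnerIn, if_neg h])

/-- A bound on the number of well-chosen actions after which a proposer is content with the
baseline `b`, its favourite among the acceptors in `J` that accept it. -/
def settleRank (J : Finset A) (b : A) (x : PState A) : ℕ :=
  match x.mood with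
  | Mood.C => if x.base = some b then 0 else if ∃ j ∈ J, x.base = some j then 2 else 4
  | Mood.H => if x.trial = some b then 1 else if ∃ j ∈ J, x.trial = some j then 3 else 5
  | Mood.W => 3
  | Mood.D => 2

theorem settleRank_le_five (J : Finset A) (b : A) (x : PState A) : settleRank J b x ≤ 5 := by
  unfold settleRank
  cases x.mood <;> simp only <;> (try split_ifs) <;> norm_num

theorem settleRank_eq_zero {J : Finset A} {b : A} {x : PState A} :
    settleRank J b x = 0 ↔ x.mood = Mood.C ∧ x.base = some b := by
  unfold settleRank
  cases x.mood <;> simp only <;> (try split_ifs) <;> simp_all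

theorem settleRank_content_le_four (J : Finset A) (b : A) {x : PState A} (hx : x.mood = Mood.C) :
    settleRank J b x ≤ 4 := by
  unfold settleRank
  rw [hx]
  simp only
  split_ifs <;> norm_num

theorem settleRank_content_le_two {J : Finset A} (b : A) {x : PState A} (hx : x.mood = Mood.C)
    {j : A} (hj : j ∈ J) (hb : x.base = some j) : settleRank J b x ≤ 2 := by
  unfold settleRank
  rw [hx]
  simp only
  split_ifs with h1 h2
  · norm_num
  · norm_num
  · exact absurd ⟨j, hj, hb⟩ h2

variable {M : Market P A} {i : P} {J : Finset A} {b : A} {x : PState A}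

theorem settleRank_ptlUpdate_eq_zero (hmax : ∀ j ∈ J, M.uP i (some j) ≤ M.uP i (some b))
    (hb : b ∈ J) (hx : x.Valid M i) (h0 : settleRank J b x = 0) (o : Option A) :
    settleRank J b (ptlUpdate x o (M.uP i (partnerIn J o))) = 0 := by
  obtain ⟨mood, base, bu, tr, tu⟩ := x
  rw [settleRank_eq_zero] at h0
  obtain ⟨hC, hbase⟩ := h0
  simp only at hC hbase
  subst hC hbase
  obtain ⟨b', hb', hbu⟩ := hx.content rfl
  simp only [Option.some.injEq] at hb' hbu
  subst hb' hbu
  have hle : M.uP i (partnerIn J o) ≤ M.uP i (some b) := by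
    rcases partnerIn_eq J o with h | ⟨j, hj, -, h⟩
    · rw [h, M.uP_none]; exact (M.uP_some_pos i b).le
    · rw [h]; exact hmax j hj
  rw [settleRank_eq_zero]
  simp only [ptlUpdate]
  split_ifs with h1 h2 h3
  · subst h1
    rw [partnerIn_some_of_mem hb] at h2
    exact absurd h2 (lt_irrefl _)
  · simp
  · subst h1
    rw [partnerIn_some_of_mem hb] at h3
    exact absurd rfl h3
  · simp

theorem exists_settleRank_ptlUpdate_lt [Fintype A] [Nonempty A] {eps : ℝ} (h1 : eps ≤ 1)
    (hmax : ∀ j ∈ J, M.uP i (some j) ≤ M.uP i (some b)) (hb : b ∈ J) (hx : x.Valid M i)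
    (h0 : settleRank J b x ≠ 0) :
    ∃ d, ENNReal.ofReal (eps / Fintype.card A) ≤ ptlAct eps x d ∧
      settleRank J b (ptlUpdate x d (M.uP i (partnerIn J d))) < settleRank J b x := by
  have hnone := M.uP_none i
  have hpos := M.uP_some_pos i
  have hc1 : ENNReal.ofReal (eps / Fintype.card A) ≤ 1 := by
    refine ENNReal.ofReal_le_one.2 (div_le_one_of_le₀ (h1.trans ?_) (by positivity))
    exact_mod_cast Nat.one_le_iff_ne_zero.2 Fintype.card_ne_zero
  obtain ⟨mood, base, bu, tr, tu⟩ := x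
  cases mood
  · obtain ⟨b', hb', hbu⟩ := hx.content rfl
    simp only at hb' hbu
    subst hb' hbu
    have hne : b' ≠ b := by
      rintro rfl
      exact h0 (settleRank_eq_zero.2 ⟨rfl, rfl⟩)
    by_cases hJ : b' ∈ J
    · refine ⟨some b, ofReal_le_ptlAct_some (Or.inl rfl) b, ?_⟩
      have hlt : M.uP i (some b') < M.uP i (some b) :=
        lt_of_le_of_ne (hmax b' hJ) fun h => hne (Option.some.inj (M.uP_inj i h))
      simp [ptlUpdate, partnerIn_some_of_mem hb, hne.symm, hne, hlt.not_ge, settleRank, hJ]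
    · refine ⟨some b', ofReal_le_ptlAct_some (Or.inl rfl) b', ?_⟩
      simp [ptlUpdate, partnerIn_some_of_not_mem hJ, hnone, hpos, settleRank, hJ, hne]
  · obtain ⟨⟨j, hj, hju⟩, hbu⟩ := hx.hopeful rfl
    simp only at hj hju hbu
    subst hj hju
    refine ⟨some j, (ptlAct_trial (x := ⟨Mood.H, base, bu, some j, M.uP i (some j)⟩) rfl).symm ▸ hc1,
      ?_⟩
    by_cases hJ : j ∈ J
    · by_cases hjb : j = b
      · subst hjb
        simp [ptlUpdate, partnerIn_some_of_mem hJ, settleRank]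
      · simp [ptlUpdate, partnerIn_some_of_mem hJ, settleRank, hjb, hJ]
    · have hjb : j ≠ b := by rintro rfl; exact hJ hb
      simp only [ptlUpdate, partnerIn_some_of_not_mem hJ, hnone, (hpos j).ne, if_false]
      split_ifs
      · simp [settleRank, hjb, hJ]
      · refine (settleRank_content_le_four J b rfl).trans_lt ?_
        simp [settleRank, hjb, hJ]
  · obtain ⟨b', hb', hbu⟩ := hx.watchful rfl
    simp only at hb' hbu
    subst hb' hbu
    refine ⟨some b', (ptlAct_base_watchful
      (x := ⟨Mood.W, some b', M.uP i (some b'), tr, tu⟩) rfl).symm ▸ hc1, ?_⟩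
    by_cases hJ : b' ∈ J
    · simp only [ptlUpdate, partnerIn_some_of_mem hJ, lt_irrefl, if_false]
      refine (settleRank_content_le_two b rfl hJ rfl).trans_lt ?_
      simp [settleRank]
    · simp [ptlUpdate, partnerIn_some_of_not_mem hJ, hnone, hpos, settleRank]
  · have hbu := hx.discontent rfl
    simp only at hbu
    subst hbu
    refine ⟨some b, ofReal_le_ptlAct_some (Or.inr rfl) b, ?_⟩
    simp [ptlUpdate, partnerIn_some_of_mem hb, (hpos b).ne', settleRank]

theorem exists_ptlUpdate_explores [Fintype A] {eps : ℝ} (h1 : eps ≤ 1) [Nonempty A]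
    (hx : ¬ (x.mood = Mood.C ∨ x.mood = Mood.D)) :
    ∃ d, ENNReal.ofReal (eps / Fintype.card A) ≤ ptlAct eps x d ∧
      ∀ u, (ptlUpdate x d u).mood = Mood.C ∨ (ptlUpdate x d u).mood = Mood.D := by
  have hc1 : ENNReal.ofReal (eps / Fintype.card A) ≤ 1 := by
    refine ENNReal.ofReal_le_one.2 (div_le_one_of_le₀ (h1.trans ?_) (by positivity))
    exact_mod_cast Nat.one_le_iff_ne_zero.2 Fintype.card_ne_zero
  obtain ⟨mood, base, bu, tr, tu⟩ := x
  cases mood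
  · simp at hx
  · refine ⟨tr, (ptlAct_trial (x := ⟨Mood.H, base, bu, tr, tu⟩) rfl).symm ▸ hc1, fun u => ?_⟩
    simp only [ptlUpdate]
    split_ifs <;> simp
  · refine ⟨base, (ptlAct_base_watchful (x := ⟨Mood.W, base, bu, tr, tu⟩) rfl).symm ▸ hc1,
      fun u => ?_⟩
    simp only [ptlUpdate]
    split_ifs <;> simp
  · simp at hx

end ProposerState

section AcceptorPolicy

variable [Fintype P]

/-- The proposer courted during stage `k` by an acceptor with learned utilities `s.1` and set of
rejecting proposers `s.2`: the first stages survey all proposers in turn, the later ones court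
the best proposer that has not rejected the acceptor. -/
def courted (k : ℕ) (s : (P → ℝ) × Finset P) : Option P :=
  if hk : k < Fintype.card P then some ((Fintype.equivFin P).symm ⟨k, hk⟩)
  else argmaxOn s.1 s.2ᶜ

/-- What an acceptor remembers of its private history: the utilities it has learned during the
survey stages, and the proposers that did not propose to it at the end of one of the `N` following
stages in which it courted them. Stages have length `L`. -/
def memory (L N : ℕ) : List (Finset P × Option P × ℝ) → (P → ℝ) × Finset P
  | [] => (fun _ => 0, ∅)
  | (S, o, u) :: v =>
    (fun i => if v.length < Fintype.card P * L ∧ o = some i ∧ i ∈ S then u else (memory L N v).1 i,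
     if Fintype.card P * L ≤ v.length ∧ v.length < (Fintype.card P + N) * L ∧ L ∣ v.length + 1 then
       (memory L N v).2 ∪
         Finset.univ.filter fun i => courted (v.length / L) (memory L N v) = some i ∧ i ∉ S
     else (memory L N v).2)

/-- The proposer courted after the private history `v`. -/
def target (L N : ℕ) (v : List (Finset P × Option P × ℝ)) : Option P :=
  courted (v.length / L) (memory L N v)

/-- The courting policy: accept the courted proposer whenever it proposes. -/
def courtingPolicy (L N : ℕ) : APolicy P A := fun S v o =>
  if o = (if ∃ i ∈ S, target L N v = some i then target L N v else none) then 1 else 0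

theorem courtingPolicy_valid (L N : ℕ) : APolicyValid (courtingPolicy L N : APolicy P A) := by
  refine fun S v => ⟨?_, fun i hi => ?_⟩
  · simp only [IsProbMass, courtingPolicy]
    exact tsum_ite_eq _ _
  · simp only [courtingPolicy, ne_eq, ite_eq_right_iff, one_ne_zero, imp_false, not_not] at hi
    split_ifs at hi with h
    obtain ⟨i', hi', ht⟩ := h
    rw [ht] at hi
    exact Option.some.inj hi ▸ hi'

variable (M : Market P A) (L N : ℕ)

/-- The utility for proposer `i` learned by acceptor `j`. -/
def learned (j : A) (h : List (Profile P A)) (i : P) : ℝ := (memory L N (aview M j h)).1 i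

/-- The proposers that have rejected acceptor `j`. -/
def rejecters (h : List (Profile P A)) (j : A) : Finset P := (memory L N (aview M j h)).2

/-- The proposers courted by the acceptors after the history `h`. -/
def courting (h : List (Profile P A)) (j : A) : Option P := target L N (aview M j h)

theorem learned_cons (j : A) (a : Profile P A) (h : List (Profile P A)) (i : P) :
    learned M L N j (a :: h) i =
      if h.length < Fintype.card P * L ∧ a.2 j = some i ∧ a.1 i = some j then M.uA j (some i)
      else learned M L N j h i := by
  have : learned M L N j (a :: h) i =
      if h.length < Fintype.card P * L ∧ a.2 j = some i ∧ i ∈ proposals a.1 j then utilA M a j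
      else learned M L N j h i := by
    simp [learned, aview, memory]
  rw [this]
  simp only [proposals, Finset.mem_filter, Finset.mem_univ, true_and]
  split_ifs with hh
  · simp [utilA, matchedA, hh.2.1, hh.2.2]
  · rfl

theorem rejecters_cons (a : Profile P A) (h : List (Profile P A)) (j : A) :
    rejecters M L N (a :: h) j =
      if Fintype.card P * L ≤ h.length ∧ h.length < (Fintype.card P + N) * L ∧
        L ∣ h.length + 1 then rejecters M L N h j ∪
          Finset.univ.filter fun i => courting M L N h j = some i ∧ a.1 i ≠ some j
      else rejecters M L N h j := by
  simp [rejecters, aview, memory, courting, target, proposals]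

theorem courting_eq (h : List (Profile P A)) (j : A) :
    courting M L N h j = courted (h.length / L) (learned M L N j h, rejecters M L N h j) := by
  simp only [courting, target, aview, List.length_map]
  rfl

variable {M L N}

theorem courting_survey {h : List (Profile P A)} (i : P)
    (hi : h.length / L = Fintype.equivFin P i) (j : A) : courting M L N h j = some i := by
  rw [courting_eq, courted, dif_pos (by rw [hi]; exact (Fintype.equivFin P i).2)]
  simp [hi]

theorem courting_cons (hL : 0 < L) {h : List (Profile P A)}
    (hh : ¬ L ∣ h.length + 1 ∨ (Fintype.card P + N) * L ≤ h.length) (a : Profile P A) :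
    courting M L N (a :: h) = courting M L N h := by
  funext j
  rw [courting_eq, courting_eq, List.length_cons]
  by_cases hlt : h.length < Fintype.card P * L
  · have hd : ¬ L ∣ h.length + 1 := by
      refine hh.resolve_right fun hle => ?_
      have : Fintype.card P * L ≤ (Fintype.card P + N) * L := by gcongr; omega
      omega
    rw [Nat.succ_div_of_not_dvd hd]
    have : h.length / L < Fintype.card P := (Nat.div_lt_iff_lt_mul hL).2 hlt
    rw [courted, courted, dif_pos this, dif_pos this]
  · have h1 : ¬ h.length / L < Fintype.card P := by rwa [Nat.div_lt_iff_lt_mul hL]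
    have h2 : ¬ (h.length + 1) / L < Fintype.card P := by
      rw [Nat.div_lt_iff_lt_mul hL]; omega
    have h3 : learned M L N j (a :: h) = learned M L N j h := by
      funext i
      rw [learned_cons, if_neg fun hc => hlt hc.1]
    have h4 : rejecters M L N (a :: h) j = rejecters M L N h j := by
      rw [rejecters_cons, if_neg]
      rintro ⟨-, h5, h6⟩
      rcases hh with hh | hh
      · exact hh h6
      · omega
    rw [h3, h4, courted, courted, dif_neg h1, dif_neg h2]

theorem courting_append (hL : 0 < L) {h : List (Profile P A)} (l : List (Profile P A))
    (hh : ∀ r < l.length, ¬ L ∣ h.length + r + 1 ∨ (Fintype.card P + N) * L ≤ h.length + r) :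
    courting M L N (l ++ h) = courting M L N h := by
  induction l with
  | nil => rfl
  | cons a l ih =>
    rw [List.cons_append, courting_cons hL, ih fun r hr => hh r (by simp; omega)]
    have := hh l.length (by simp)
    rw [List.length_append, add_comm l.length]
    exact this

theorem rejecters_append {h : List (Profile P A)} (l : List (Profile P A))
    (hh : ∀ r < l.length, ¬ (Fintype.card P * L ≤ h.length + r ∧ L ∣ h.length + r + 1)) :
    rejecters M L N (l ++ h) = rejecters M L N h := by
  induction l with
  | nil => rfl
  | cons a l ih =>
    rw [← ih fun r hr => hh r (by simp; omega)]
    funext j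
    rw [List.cons_append, rejecters_cons, if_neg]
    have := hh l.length (by simp)
    rw [List.length_append, add_comm l.length]
    tauto

theorem learned_append {h : List (Profile P A)} {i : P} {j : A}
    (hi : learned M L N j h i = M.uA j (some i)) (l : List (Profile P A)) :
    learned M L N j (l ++ h) i = M.uA j (some i) := by
  induction l with
  | nil => exact hi
  | cons a l ih =>
    rw [List.cons_append, learned_cons, ih, ite_self]

variable [Fintype A] {piP : PPolicy P A} {a : Profile P A} {h : List (Profile P A)}

theorem acceptor_action_of_support (ha : stepProb M piP (courtingPolicy L N) h a ≠ 0) (j : A) :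
    a.2 j = if ∃ i, a.1 i = some j ∧ courting M L N h j = some i then courting M L N h j
      else none := by
  rw [stepProb, mul_ne_zero_iff, Finset.prod_ne_zero_iff, Finset.prod_ne_zero_iff] at ha
  have := ha.2 j (Finset.mem_univ j)
  simp [courtingPolicy, proposals] at this
  by_cases hc : ∃ i, a.1 i = some j ∧ courting M L N h j = some i
  · exact (this.trans (if_pos hc)).trans (if_pos hc).symm
  · exact (this.trans (if_neg hc)).trans (if_neg hc).symm

theorem acceptor_action_eq_some (ha : stepProb M piP (courtingPolicy L N) h a ≠ 0) {i : P} {j : A} :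
    a.2 j = some i ↔ a.1 i = some j ∧ courting M L N h j = some i := by
  rw [acceptor_action_of_support ha]
  constructor
  · intro hs
    split_ifs at hs with hc
    obtain ⟨i', h1, h2⟩ := hc
    rw [h2] at hs ⊢
    obtain rfl := Option.some.inj hs
    exact ⟨h1, rfl⟩
  · rintro ⟨h1, h2⟩
    rw [if_pos ⟨i, h1, h2⟩, h2]

theorem matchedP_of_support (ha : stepProb M piP (courtingPolicy L N) h a ≠ 0) (i : P) :
    matchedP a i = partnerIn (courters (courting M L N h) i) (a.1 i) := by
  unfold matchedP
  cases hi : a.1 i with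
  | none => simp [partnerIn]
  | some j =>
    by_cases hj : courting M L N h j = some i
    · simp [acceptor_action_eq_some ha, hi, hj, partnerIn_some_of_mem (mem_courters.2 hj)]
    · rw [partnerIn_some_of_not_mem (by rwa [mem_courters])]
      simp [acceptor_action_eq_some ha, hj]

end AcceptorPolicy

section Convergence

variable [Fintype P] [Fintype A] [Nonempty P] [Nonempty A]

/-- The expectation operator of the game in which proposers follow PTL and acceptors follow the
courting policy. -/
abbrev courtingE (M : Market P A) (eps : ℝ) (L N : ℕ) :
    (List (Profile P A) → ℝ≥0∞) → List (Profile P A) → ℝ≥0∞ :=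
  stepE M (PTL eps) (courtingPolicy L N)

variable {M : Market P A} {eps : ℝ} {L N : ℕ}

theorem sum_PTL (h0 : 0 ≤ eps) (h1 : eps + eps ^ 2 ≤ 1) (v : List (Option A × ℝ)) :
    ∑ o, (PTL eps : PPolicy P A) v o = 1 := sum_ptlAct h0 h1 _

theorem div_card_mem_Icc (h0 : 0 ≤ eps) (h1 : eps + eps ^ 2 ≤ 1) :
    0 ≤ eps / Fintype.card A ∧ eps / Fintype.card A ≤ 1 := by
  refine ⟨by positivity, div_le_one_of_le₀ ?_ (by positivity)⟩
  have : (1 : ℝ) ≤ Fintype.card A := by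
    exact_mod_cast Nat.one_le_iff_ne_zero.2 Fintype.card_ne_zero
  nlinarith

/-- While the courted proposers do not change, a proposer settles on its favourite courter. -/
theorem iterate_unsettled_le (h0 : 0 ≤ eps) (h1 : eps + eps ^ 2 ≤ 1) (hL : 0 < L) (i : P) {b : A}
    (m : ℕ) (h : List (Profile P A))
    (hh : ∀ r < m, ¬ L ∣ h.length + r + 1 ∨ (Fintype.card P + N) * L ≤ h.length + r)
    (hb : bestCourter M (courting M L N h) i = some b) :
    (courtingE M eps L N)^[m]
      (fun h' => if settleRank (courters (courting M L N h) i) b (ptlState M i h') = 0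
        then 0 else 1) h ≤ 2 * rankRate (eps / Fintype.card A) ^ m := by
  have hc := div_card_mem_Icc (A := A) h0 h1
  obtain ⟨hbm, hmax⟩ := argmaxOn_eq_some hb
  refine iterate_stepE_rank_ne_zero_le (M := M) (sum_PTL h0 h1) (courtingPolicy_valid L N) hc.1 hc.2
    (r := fun h' => settleRank (courters (courting M L N h) i) b (ptlState M i h'))
    (fun h' => settleRank_le_five _ _ _) m h fun l hl => ?_
  have hcourt : courting M L N (l ++ h) = courting M L N h :=
    courting_append hL l fun r hr => hh r (hr.trans hl)
  have hupd : ∀ a, stepProb M (PTL eps) (courtingPolicy L N) (l ++ h) a ≠ 0 →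
      ptlState M i (a :: (l ++ h)) = ptlUpdate (ptlState M i (l ++ h)) (a.1 i)
        (M.uP i (partnerIn (courters (courting M L N h) i) (a.1 i))) := by
    intro a ha
    rw [ptlState_cons, matchedP_of_support ha, hcourt]
  have hv := ptlState_valid M i (l ++ h)
  constructor
  · intro hz a ha
    simp only [hupd a ha]
    exact settleRank_ptlUpdate_eq_zero hmax hbm hv hz _
  · intro hz
    obtain ⟨d, hd, hlt⟩ := exists_settleRank_ptlUpdate_lt (eps := eps) (by nlinarith) hmax hbm hv hz
    refine ⟨i, d, hd, fun a ha had => ?_⟩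
    simp only [hupd a ha, had]
    exact hlt

/-- After a period in which the courted proposers do not change, all courted proposers are likely
to propose to their favourite courters. -/
theorem iterate_last_action_le (h0 : 0 ≤ eps) (h1 : eps + eps ^ 2 ≤ 1) (hL : 0 < L) (m : ℕ)
    (h : List (Profile P A))
    (hh : ∀ r < m, ¬ L ∣ h.length + r + 1 ∨ (Fintype.card P + N) * L ≤ h.length + r)
    (F : List (Profile P A) → ℝ≥0∞) (hF1 : ∀ h', F h' ≤ 1)
    (hF : ∀ (l : List (Profile P A)) (a : Profile P A), l.length = m →
      courting M L N (l ++ h) = courting M L N h →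
      stepProb M (PTL eps) (courtingPolicy L N) (l ++ h) a ≠ 0 →
      (∀ i b, bestCourter M (courting M L N h) i = some b → a.1 i = some b) →
      F (a :: (l ++ h)) = 0) :
    (courtingE M eps L N)^[m + 1] F h ≤ Fintype.card P *
      (ENNReal.ofReal eps + ENNReal.ofReal eps ^ 2 +
        2 * rankRate (eps / Fintype.card A) ^ m) := by
  set τ := courting M L N h with hτ
  set U : P → List (Profile P A) → ℝ≥0∞ := fun i h' =>
    if ∃ b, bestCourter M τ i = some b ∧ settleRank (courters τ i) b (ptlState M i h') ≠ 0
    then 1 else 0 with hU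
  have hUle : ∀ i, (courtingE M eps L N)^[m] (U i) h ≤
      2 * rankRate (eps / Fintype.card A) ^ m := by
    intro i
    cases hb : bestCourter M τ i with
    | none =>
      have : U i = fun _ => 0 := by funext h'; simp [hU, hb]
      rw [this, iterate_stepE_zero]
      exact zero_le
    | some b =>
      have : U i = fun h' => if settleRank (courters τ i) b (ptlState M i h') = 0
          then 0 else 1 := by
        funext h'
        simp [hU, hb]
      rw [this]
      exact iterate_unsettled_le h0 h1 hL i m h hh hb
  have hstep : ∀ l : List (Profile P A), l.length = m → courtingE M eps L N F (l ++ h) ≤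
      ∑ i, ((ENNReal.ofReal eps + ENNReal.ofReal eps ^ 2) + U i (l ++ h)) := by
    intro l hl
    have hcourt : courting M L N (l ++ h) = τ :=
      courting_append hL l fun r hr => hh r (hr.trans_eq hl)
    set g : P → Option A → ℝ≥0∞ := fun i o =>
      if ∃ b, bestCourter M τ i = some b ∧ o ≠ some b then 1 else 0 with hg
    calc courtingE M eps L N F (l ++ h)
        ≤ ∑ a, stepProb M (PTL eps) (courtingPolicy L N) (l ++ h) a * ∑ i, g i (a.1 i) := by
          refine Finset.sum_le_sum fun a _ => ?_
          by_cases ha : stepProb M (PTL eps) (courtingPolicy L N) (l ++ h) a = 0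
          · simp [ha]
          gcongr
          by_cases hgood : ∀ i b, bestCourter M τ i = some b → a.1 i = some b
          · rw [hF l a hl hcourt ha hgood]
            exact zero_le
          · push Not at hgood
            obtain ⟨i, b, hb, hne⟩ := hgood
            refine (hF1 _).trans ?_
            calc (1 : ℝ≥0∞) = g i (a.1 i) := by
                  simp only [hg]
                  rw [if_pos ⟨b, hb, hne⟩]
              _ ≤ _ := Finset.single_le_sum (f := fun i => g i (a.1 i)) (fun _ _ => zero_le)
                  (Finset.mem_univ i)
      _ = ∑ i, ∑ o, ptlAct eps (ptlState M i (l ++ h)) o * g i o := by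
          simp only [Finset.mul_sum]
          rw [Finset.sum_comm]
          refine Finset.sum_congr rfl fun i _ => ?_
          rw [sum_stepProb_apply (sum_PTL h0 h1) (courtingPolicy_valid L N), Finset.sum_congr rfl]
          exact fun o _ => rfl
      _ ≤ _ := by
          refine Finset.sum_le_sum fun i _ => ?_
          cases hb : bestCourter M τ i with
          | none => simp [hg, hb]
          | some b =>
            by_cases hz : settleRank (courters τ i) b (ptlState M i (l ++ h)) = 0
            · obtain ⟨hC, hbase⟩ := settleRank_eq_zero.1 hz
              refine le_trans (le_of_eq ?_) ((sum_ptlAct_ne_base_le eps hC).trans le_self_add)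
              refine Finset.sum_congr rfl fun o _ => ?_
              rw [hbase]
              by_cases ho : o = some b <;> simp [hg, hb, ho]
            · have : U i (l ++ h) = 1 := by simp [hU, hb, hz]
              rw [this]
              refine le_trans ?_ le_add_self
              rw [← sum_ptlAct h0 h1 (ptlState M i (l ++ h))]
              refine Finset.sum_le_sum fun o _ => mul_le_of_le_one_right' ?_
              simp only [hg]
              split_ifs <;> simp
  rw [Function.iterate_succ_apply]
  refine (iterate_stepE_le (g := fun h' => ∑ i, ((ENNReal.ofReal eps + ENNReal.ofReal eps ^ 2) +
    U i h')) _ _ _ m h hstep).trans ?_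
  rw [iterate_stepE_sum]
  refine (Finset.sum_le_sum fun i _ => ?_).trans_eq
    (by rw [Finset.sum_const, Finset.card_univ, nsmul_eq_mul])
  rw [iterate_stepE_add, iterate_stepE_const (sum_PTL h0 h1) (courtingPolicy_valid L N)]
  gcongr
  exact hUle i

/-- During the stage in which proposer `i` is surveyed, every acceptor learns its utility. -/
theorem iterate_unlearned_le (h0 : 0 ≤ eps) (h1 : eps + eps ^ 2 ≤ 1) (hL : 0 < L) (i : P) (j : A)
    {h : List (Profile P A)} (hh : h.length = Fintype.equivFin P i * L) :
    (courtingE M eps L N)^[L]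
      (fun h' => if learned M L N j h' i = M.uA j (some i) then 0 else 1) h ≤
      2 * rankRate (eps / Fintype.card A) ^ L := by
  have hc := div_card_mem_Icc (A := A) h0 h1
  set r : List (Profile P A) → ℕ := fun h' =>
    if learned M L N j h' i = M.uA j (some i) then 0
    else if (ptlState M i h').mood = Mood.C ∨ (ptlState M i h').mood = Mood.D then 1 else 2 with hr
  have hr0 : ∀ h', r h' = 0 ↔ learned M L N j h' i = M.uA j (some i) := by
    intro h'
    simp only [hr]
    split_ifs with h2 h3 <;> simp [h2]
  have key := iterate_stepE_rank_ne_zero_le (M := M) (sum_PTL h0 h1) (courtingPolicy_valid L N)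
    hc.1 hc.2 (r := r) (fun h' => by simp only [hr]; split_ifs <;> norm_num) L h fun l hl => ?_
  · simpa only [hr0] using key
  have hlen : (l ++ h).length = l.length + L * (Fintype.equivFin P i : ℕ) := by
    rw [List.length_append, hh, mul_comm]
  have hdiv : (l ++ h).length / L = Fintype.equivFin P i := by
    rw [hlen, Nat.add_mul_div_left _ _ hL, Nat.div_eq_of_lt hl, zero_add]
  have hlt : (l ++ h).length < Fintype.card P * L := by
    rw [← Nat.div_lt_iff_lt_mul hL, hdiv]
    exact (Fintype.equivFin P i).2
  constructor
  · intro hz a _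
    rw [hr0] at hz ⊢
    exact learned_append hz [a]
  · intro hz
    rw [ne_eq, hr0] at hz
    by_cases hm : (ptlState M i (l ++ h)).mood = Mood.C ∨ (ptlState M i (l ++ h)).mood = Mood.D
    · refine ⟨i, some j, ofReal_le_ptlAct_some hm j, fun a ha had => ?_⟩
      have : r (a :: (l ++ h)) = 0 := by
        rw [hr0, learned_cons, if_pos]
        exact ⟨hlt, (acceptor_action_eq_some ha).2 ⟨had, courting_survey i hdiv j⟩, had⟩
      rw [this]
      simp [hr, hz, hm]
    · obtain ⟨d, hd, hmood⟩ := exists_ptlUpdate_explores (eps := eps) (by nlinarith) hm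
      refine ⟨i, d, hd, fun a _ had => ?_⟩
      have h2 : r (l ++ h) = 2 := by simp only [hr, if_neg hz, if_neg hm]
      have h3 := hmood (M.uP i (matchedP a i))
      rw [← had, ← ptlState_cons] at h3
      rw [h2]
      simp only [hr, if_pos h3]
      split_ifs <;> norm_num

/-- At the beginning of stage `k`, the acceptors' memories agree with those of deferred
acceptance. -/
def OnTrack (M : Market P A) (L N k : ℕ) (h : List (Profile P A)) : Prop :=
  (∀ i j, (Fintype.equivFin P i : ℕ) < k → learned M L N j h i = M.uA j (some i)) ∧
    rejecters M L N h = daSeq M (k - Fintype.card P)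

theorem OnTrack.courting_eq (hL : 0 < L) {k : ℕ} (hk : Fintype.card P ≤ k)
    {h : List (Profile P A)} (ht : OnTrack M L N k h) (hh : k * L ≤ h.length) :
    courting M L N h = daTarget M (daSeq M (k - Fintype.card P)) := by
  funext j
  have h1 : ¬ h.length / L < Fintype.card P := by
    rw [not_lt, Nat.le_div_iff_mul_le hL]
    exact (Nat.mul_le_mul_right L hk).trans hh
  rw [_root_.courting_eq, courted, dif_neg h1, daTarget, ht.2]
  congr 1
  funext i
  exact ht.1 i j ((Fintype.equivFin P i).2.trans_le hk)

/-- The error bound for a single stage. -/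
def stageError (P A : Type) [Fintype P] [Fintype A] (eps : ℝ) (L : ℕ) : ℝ≥0∞ :=
  (Fintype.card P + Fintype.card A) * (ENNReal.ofReal eps + ENNReal.ofReal eps ^ 2 +
    2 * rankRate (eps / Fintype.card A) ^ (L - 1))

theorem rankRate_le_one {c : ℝ} (hc : 0 ≤ c) : rankRate c ≤ 1 := by
  rw [rankRate, ENNReal.ofReal_le_one]
  have : 0 ≤ (c / 2) ^ 5 := by positivity
  linarith

theorem iterate_last_action_le_stageError (h0 : 0 ≤ eps) (m : ℕ) (hm : L - 1 ≤ m) :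
    Fintype.card P * (ENNReal.ofReal eps + ENNReal.ofReal eps ^ 2 +
        2 * rankRate (eps / Fintype.card A) ^ m) ≤ stageError P A eps L := by
  have hp := pow_le_pow_right_of_le_one'
    (rankRate_le_one (by positivity : 0 ≤ eps / Fintype.card A)) hm
  exact mul_le_mul' le_self_add (add_le_add le_rfl (mul_le_mul' le_rfl hp))

theorem iterate_survey_le (h0 : 0 ≤ eps) (h1 : eps + eps ^ 2 ≤ 1) (hL : 0 < L) {k : ℕ}
    (hk : k < Fintype.card P) {h : List (Profile P A)} (hh : h.length = k * L)
    (ht : OnTrack M L N k h) :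
    (courtingE M eps L N)^[L] (fun h' => if OnTrack M L N (k + 1) h' then 0 else 1) h ≤
      stageError P A eps L := by
  set i := (Fintype.equivFin P).symm ⟨k, hk⟩ with hi
  have hik : (Fintype.equivFin P i : ℕ) = k := by simp [hi]
  calc _ ≤ (courtingE M eps L N)^[L] (fun h' => ∑ j : A,
        if learned M L N j h' i = M.uA j (some i) then 0 else 1) h := by
        refine iterate_stepE_le _ _ _ L h fun l hl => ?_
        split_ifs with hn
        · exact zero_le
        · by_contra hsum
          refine hn ⟨fun i' j hi' => ?_, ?_⟩
          · rcases Nat.lt_succ_iff_lt_or_eq.1 hi' with hlt | heq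
            · exact learned_append (ht.1 i' j hlt) l
            · obtain rfl : i' = i := by
                apply (Fintype.equivFin P).injective
                exact Fin.ext (heq.trans hik.symm)
              by_contra hne
              refine hsum (le_trans ?_ (Finset.single_le_sum (fun _ _ => zero_le)
                (Finset.mem_univ j)))
              rw [if_neg hne]
          · rw [rejecters_append, ht.2, Nat.sub_eq_zero_of_le hk.le, Nat.sub_eq_zero_of_le hk]
            rintro r hr ⟨hle, -⟩
            have : (k + 1) * L ≤ Fintype.card P * L := Nat.mul_le_mul_right L hk
            rw [add_mul, one_mul] at this
            omega
    _ ≤ ∑ _j : A, 2 * rankRate (eps / Fintype.card A) ^ L := by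
        rw [iterate_stepE_sum]
        exact Finset.sum_le_sum fun j _ => iterate_unlearned_le h0 h1 hL i j (by rw [hik, hh])
    _ ≤ _ := by
        rw [Finset.sum_const, Finset.card_univ, nsmul_eq_mul, stageError]
        have hp := pow_le_pow_right_of_le_one'
          (rankRate_le_one (div_card_mem_Icc (A := A) h0 h1).1) (Nat.sub_le L 1)
        exact mul_le_mul' le_add_self ((mul_le_mul' le_rfl hp).trans le_add_self)

theorem iterate_deferred_le (h0 : 0 ≤ eps) (h1 : eps + eps ^ 2 ≤ 1) (hL : 0 < L) {k : ℕ}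
    (hk : Fintype.card P ≤ k) (hkN : k < Fintype.card P + N) {h : List (Profile P A)}
    (hh : h.length = k * L) (ht : OnTrack M L N k h) :
    (courtingE M eps L N)^[L] (fun h' => if OnTrack M L N (k + 1) h' then 0 else 1) h ≤
      stageError P A eps L := by
  obtain ⟨m, rfl⟩ : ∃ m, L = m + 1 := Nat.exists_eq_succ_of_ne_zero hL.ne'
  have hnd : ∀ r < m, ¬ (m + 1) ∣ h.length + r + 1 := by
    intro r hr hd
    rw [hh, add_assoc, Nat.dvd_add_right (Dvd.intro_left k rfl)] at hd
    exact absurd (Nat.le_of_dvd (Nat.succ_pos r) hd) (by omega)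
  refine (iterate_last_action_le h0 h1 hL m h (fun r hr => Or.inl (hnd r hr)) _
    (fun h' => ?_) fun l a hl hcourt ha hbest => ?_).trans
    (iterate_last_action_le_stageError h0 m (by simp))
  · split_ifs <;> simp
  · rw [if_pos]
    have hrej : rejecters M (m + 1) N (l ++ h) = rejecters M (m + 1) N h :=
      rejecters_append l fun r hr hc => hnd r (hr.trans_eq hl) hc.2
    refine ⟨fun i j _ => ?_, ?_⟩
    · exact learned_append (ht.1 i j ((Fintype.equivFin P i).2.trans_le hk)) (a :: l)
    · have hc := ht.courting_eq hL hk hh.ge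
      funext j
      rw [rejecters_cons, if_pos, hrej, ht.2, hcourt, Nat.sub_add_comm hk, daSeq_succ]
      · ext i
        rw [mem_daStep, ← hc]
        simp only [Finset.mem_union, Finset.mem_filter, Finset.mem_univ, true_and]
        refine or_congr_right (and_congr_right fun hij => not_congr ?_)
        obtain ⟨b, hb, -⟩ := exists_argmaxOn (f := fun j => M.uP i (some j)) (mem_courters.2 hij)
        have hb' : bestCourter M (courting M (m + 1) N h) i = some b := hb
        rw [hb', hbest i b hb']
      · rw [List.length_append, hl, hh]
        refine ⟨(Nat.mul_le_mul_right _ hk).trans (Nat.le_add_left _ _), ?_, ⟨k + 1, by ring⟩⟩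
        have : (k + 1) * (m + 1) ≤ (Fintype.card P + N) * (m + 1) := Nat.mul_le_mul_right _ hkN
        rw [add_mul, one_mul] at this
        omega

/-- The matching formed in the latest round of the history is `μ`. -/
def LastMatching (μ : Profile P A) (h : List (Profile P A)) : Prop :=
  ∃ a h', h = a :: h' ∧ induced a = μ

theorem iterate_final_le (h0 : 0 ≤ eps) (h1 : eps + eps ^ 2 ≤ 1) (hL : 0 < L)
    {μ : Profile P A} (hcons : Consistent μ) (hN : daTarget M (daSeq M N) = μ.2)
    {h : List (Profile P A)} (hh : h.length = (Fintype.card P + N) * L)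
    (ht : OnTrack M L N (Fintype.card P + N) h) (m : ℕ) (hm : L - 1 ≤ m) :
    (courtingE M eps L N)^[m + 1]
      (fun h' => if LastMatching μ h' then 0 else 1) h ≤
      stageError P A eps L := by
  have hcourt : courting M L N h = μ.2 := by
    rw [ht.courting_eq hL (Nat.le_add_right _ _) hh.ge, Nat.add_sub_cancel_left, hN]
  refine (iterate_last_action_le h0 h1 hL m h (fun r _ => Or.inr (by omega)) _
    (fun h' => ?_) fun l a hl hcl ha hbest => ?_).trans (iterate_last_action_le_stageError h0 m hm)
  · split_ifs <;> simp
  · rw [if_pos]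
    refine ⟨a, l ++ h, rfl, ?_⟩
    have hplay : ∀ i j, μ.2 j = some i → a.1 i = some j := by
      intro i j hij
      rw [hcourt] at hbest
      obtain ⟨b, hb, hbm, -⟩ := exists_argmaxOn (f := fun j => M.uP i (some j))
        (mem_courters.2 hij)
      rw [hbest i b hb]
      rw [mem_courters, ← hcons] at hbm
      rw [← hcons, hbm] at hij
      exact hij
    have hacc : ∀ i j, a.2 j = some i ↔ μ.2 j = some i := by
      intro i j
      rw [acceptor_action_eq_some ha, hcl, hcourt]
      exact ⟨And.right, fun hij => ⟨hplay i j hij, hij⟩⟩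
    have hA : matchedA a = μ.2 := by
      funext j
      have : a.2 j = μ.2 j := Option.ext fun i => hacc i j
      unfold matchedA
      rw [this]
      cases hj : μ.2 j with
      | none => rfl
      | some i => simp [hplay i j hj]
    have hP : matchedP a = μ.1 := by
      funext i
      refine Option.ext fun j => ?_
      rw [hcons, ← hacc]
      unfold matchedP
      cases hi : a.1 i with
      | none =>
        simp only [reduceCtorEq, false_iff]
        intro hj
        rw [hacc] at hj
        rw [hplay i j hj] at hi
        cases hi
      | some j' =>
        by_cases hj' : a.2 j' = some i
        · simp only [hj', if_true, Option.some.injEq]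
          constructor
          · rintro rfl
            exact hj'
          · intro hj
            rw [hacc] at hj
            rw [hplay i j hj] at hi
            exact (Option.some.inj hi).symm
        · simp only [hj', if_false, reduceCtorEq, false_iff]
          intro hj
          have := hplay i j ((hacc i j).1 hj)
          rw [hi] at this
          exact hj' (Option.some.inj this ▸ hj)
    rw [induced, hP, hA]

theorem iterate_add_le (h0 : 0 ≤ eps) (h1 : eps + eps ^ 2 ≤ 1) {t m : ℕ}
    {G : List (Profile P A) → Prop} {F : List (Profile P A) → ℝ≥0∞} {α β : ℝ≥0∞}
    (hF1 : ∀ h, F h ≤ 1)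
    (hG : (courtingE M eps L N)^[t] (fun h => if G h then 0 else 1) [] ≤ α)
    (hF : ∀ h : List (Profile P A), h.length = t → G h → (courtingE M eps L N)^[m] F h ≤ β) :
    (courtingE M eps L N)^[t + m] F [] ≤ α + β := by
  rw [Function.iterate_add_apply]
  calc _ ≤ (courtingE M eps L N)^[t] (fun h => (if G h then 0 else 1) + β) [] := by
        refine iterate_stepE_le _ _ _ t [] fun l hl => ?_
        split_ifs with hg
        · rw [zero_add]
          exact hF _ (by simpa using hl) hg
        · refine le_trans ?_ le_self_add
          refine (iterate_stepE_le (g := fun _ => 1) _ _ _ m _ fun l _ => hF1 _).trans_eq ?_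
          exact iterate_stepE_const (sum_PTL h0 h1) (courtingPolicy_valid L N) 1 m _
    _ ≤ _ := by
        rw [iterate_stepE_add, iterate_stepE_const (sum_PTL h0 h1) (courtingPolicy_valid L N)]
        gcongr

theorem iterate_onTrack_le (h0 : 0 ≤ eps) (h1 : eps + eps ^ 2 ≤ 1) (hL : 0 < L) (k : ℕ)
    (hk : k ≤ Fintype.card P + N) :
    (courtingE M eps L N)^[k * L] (fun h => if OnTrack M L N k h then 0 else 1) [] ≤
      k * stageError P A eps L := by
  induction k with
  | zero =>
    have : OnTrack M L N 0 ([] : List (Profile P A)) := by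
      refine ⟨fun i j h => absurd h (Nat.not_lt_zero _), ?_⟩
      funext j
      simp [rejecters, aview, memory, daSeq]
    simp [this]
  | succ k ih =>
    rw [add_mul, one_mul, Nat.cast_add, add_mul, Nat.cast_one, one_mul]
    refine iterate_add_le h0 h1 (fun h => by split_ifs <;> simp) (ih (by omega)) fun h hh ht => ?_
    rcases lt_or_ge k (Fintype.card P) with hlt | hge
    · exact iterate_survey_le h0 h1 hL hlt hh ht
    · exact iterate_deferred_le h0 h1 hL hge (by omega) hh ht

theorem eventProb_compl_le (h0 : 0 ≤ eps) (h1 : eps + eps ^ 2 ≤ 1) (hL : 0 < L)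
    {μ : Profile P A} (hcons : Consistent μ) (hN : daTarget M (daSeq M N) = μ.2) (t : ℕ)
    (ht : (Fintype.card P + N + 1) * L ≤ t) :
    (courtingE M eps L N)^[t] (fun h => if LastMatching μ h then 0 else 1) [] ≤
      (Fintype.card P + N + 1 : ℕ) * stageError P A eps L := by
  rw [add_mul, one_mul] at ht
  obtain ⟨m, rfl⟩ : ∃ m, t = (Fintype.card P + N) * L + (m + 1) :=
    ⟨t - (Fintype.card P + N) * L - 1, by omega⟩
  rw [Nat.cast_add _ 1, add_mul _ _ (stageError P A eps L), Nat.cast_one, one_mul]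
  exact iterate_add_le h0 h1 (fun h => by split_ifs <;> simp) (iterate_onTrack_le h0 h1 hL _ le_rfl)
    fun h hh hot => iterate_final_le h0 h1 hL hcons hN hh hot m (by omega)

theorem eventProb_add_compl (h0 : 0 ≤ eps) (h1 : eps + eps ^ 2 ≤ 1) (t : ℕ)
    (G : List (Profile P A) → Prop) :
    eventProb M (PTL eps) (courtingPolicy L N) t {h | G h} +
      (courtingE M eps L N)^[t] (fun h => if G h then 0 else 1) [] = 1 := by
  rw [eventProb_eq, ← iterate_stepE_add]
  have : (fun h => {h | G h}.indicator 1 h + if G h then 0 else 1) =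
      fun _ : List (Profile P A) => (1 : ℝ≥0∞) := by
    funext h
    by_cases hG : G h <;> simp [hG]
  rw [this]
  exact iterate_stepE_const (sum_PTL h0 h1) (courtingPolicy_valid L N) 1 t []

theorem one_sub_lt_of_add_eq_one {p q d : ℝ≥0∞} (hd : d ≤ 1) (hpq : p + q = 1) (hq : q < d) :
    1 - d < p := by
  have hp : p ≠ ⊤ := ne_top_of_le_ne_top ENNReal.one_ne_top (hpq ▸ le_self_add)
  refine ENNReal.sub_lt_of_lt_add hd ?_
  rw [← hpq]
  exact ENNReal.add_lt_add_left hp hq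

/-- The stage error can be made arbitrarily small. -/
theorem exists_stageError_lt (P A : Type) [Fintype P] [Fintype A] [Nonempty A] {η : ℝ}
    (hη : 0 < η) :
    ∃ eps : ℝ, 0 < eps ∧ eps + eps ^ 2 ≤ 1 ∧ ∃ L, 0 < L ∧
      stageError P A eps L < ENNReal.ofReal η := by
  set D : ℝ := Fintype.card P + Fintype.card A with hD
  have hA : (1 : ℝ) ≤ Fintype.card A := by
    exact_mod_cast Nat.one_le_iff_ne_zero.2 Fintype.card_ne_zero
  have hD1 : 1 ≤ D := by
    have : (0 : ℝ) ≤ Fintype.card P := by positivity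
    linarith
  set eps : ℝ := min (1 / 2) (η / (8 * D)) with heps
  have hD0 : 0 < D := by linarith
  have he0 : 0 < eps := lt_min (by norm_num) (by positivity)
  have he2 : eps ≤ 1 / 2 := min_le_left _ _
  have heD : D * eps ≤ η / 8 := by
    calc D * eps ≤ D * (η / (8 * D)) := by gcongr; exact min_le_right _ _
      _ = η / 8 := by field_simp
  have hc0 : 0 < eps / Fintype.card A := by positivity
  have hc1 : eps / Fintype.card A ≤ 1 := div_le_one_of_le₀ (by linarith) (by positivity)
  set x : ℝ := 1 - (eps / Fintype.card A / 2) ^ 5 with hx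
  have hx0 : 0 ≤ x := sub_nonneg.2 (pow_le_one₀ (by positivity) (by linarith))
  have hx1 : x < 1 := sub_lt_self _ (by positivity)
  obtain ⟨n, hn⟩ := exists_pow_lt_of_lt_one (show 0 < η / (8 * D) by positivity) hx1
  refine ⟨eps, he0, by nlinarith, n + 1, Nat.succ_pos n, ?_⟩
  have hval : stageError P A eps (n + 1) =
      ENNReal.ofReal (D * (eps + eps ^ 2 + 2 * x ^ n)) := by
    have hDe : ENNReal.ofReal D = Fintype.card P + Fintype.card A := by
      rw [hD, ENNReal.ofReal_add (by positivity) (by positivity)]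
      simp
    rw [ENNReal.ofReal_mul hD0.le, hDe, ENNReal.ofReal_add (p := eps + eps ^ 2) (by positivity) (by positivity),
      ENNReal.ofReal_add he0.le (by positivity), ENNReal.ofReal_mul (by norm_num),
      ENNReal.ofReal_pow he0.le, ENNReal.ofReal_pow hx0]
    simp [stageError, rankRate, hx]
  rw [hval]
  refine (ENNReal.ofReal_lt_ofReal_iff hη).2 ?_
  have h1 : D * x ^ n < η / 8 := by
    calc D * x ^ n < D * (η / (8 * D)) := by gcongr
      _ = η / 8 := by field_simp
  nlinarith [mul_pos hD0 he0]

end Convergence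

/-- For every market with acceptor-optimal stable matching `μ*` and every
`δ ∈ (0, 1]`, there exist an experimentation rate `ε > 0` and a completely uncoupled
acceptor policy such that, if every proposer follows PTL with rate `ε` and every acceptor
follows that policy, the probability that the matching formed at time `t` equals `μ*`
exceeds `1 - δ` for all sufficiently large `t`. -/
theorem statement1 [Fintype P] [Fintype A] [Nonempty P] [Nonempty A] (M : Market P A)
    (μstar : Profile P A) (hcons : Consistent μstar) (hstab : Stable M μstar)
    (hopt : ∀ μ : Profile P A, Consistent μ → Stable M μ →
      ∀ j, M.uA j (μ.2 j) ≤ M.uA j (μstar.2 j))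
    (δ : ℝ) (hδ : δ ∈ Set.Ioc (0 : ℝ) 1) :
    ∃ eps : ℝ, 0 < eps ∧ ∃ piA : APolicy P A, APolicyValid piA ∧
      ∃ T : ℕ, ∀ t ≥ T,
        1 - ENNReal.ofReal δ <
          eventProb M (PTL eps) piA t {h | ∃ a h', h = a :: h' ∧ induced a = μstar} := by
  obtain ⟨N, hN⟩ := exists_daSeq_fixed M
  have hN' := daTarget_eq_of_fixed M hcons hstab hopt hN
  obtain ⟨eps, h0, h1, L, hL, hlt⟩ := exists_stageError_lt P A
    (div_pos hδ.1 (by positivity : (0 : ℝ) < (Fintype.card P + N + 1 : ℕ)))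
  refine ⟨eps, h0, courtingPolicy L N, courtingPolicy_valid L N,
    (Fintype.card P + N + 1) * L, fun t ht => ?_⟩
  refine one_sub_lt_of_add_eq_one (ENNReal.ofReal_le_one.2 hδ.2)
    (eventProb_add_compl h0.le h1 t (LastMatching μstar)) ?_
  refine (eventProb_compl_le h0.le h1 hL hcons hN' t ht).trans_lt ?_
  rw [ENNReal.ofReal_div_of_pos (by positivity), ENNReal.ofReal_natCast] at hlt
  rw [mul_comm]
  exact (ENNReal.lt_div_iff_mul_lt (by simp) (by simp)).1 hlt

end
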